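/- arXiv:2110.03268 — 2 statements merged into one kernel-verified Lean document; each statement's English description precedes it below -/
import Mathlib

section
/- Let Γ be a finite group and c : Γ → ℤ. Then Σ_{g ∈ Γ} i · c(g) · χ(g) is an integer for every irreducible complex character χ of Γ if and only if the following three conditions hold: (i) Σ_{s ∈ Cl(g₁)} c(s) = Σ_{s ∈ Cl(g₂)} c(s) for all g₁, g₂ ∈ Γ(4) with g₁ ≈ g₂; (ii) Σ_{s ∈ Cl(g)} c(s) = − Σ_{s ∈ Cl(g⁻¹)} c(s) for all g ∈ Γ; and (iii) Σ_{s ∈ Cl(g)} c(s) = 0 for all g ∈ Γ ∖ Γ(4). -/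
open scoped Classical

noncomputable section

/-- The sum of `c` over the conjugacy class of `g`. -/
def conjClassSum {Γ : Type} [Group Γ] [Fintype Γ] (c : Γ → ℤ) (g : Γ) : ℤ :=
  ∑ s ∈ Finset.univ.filter (fun s => IsConj g s), c s

/-- `g₁ ≈ g₂` : `g₂ = g₁^k` for some `k` with `gcd(k, ord(g₁)) = 1` and `k ≡ 1 (mod 4)`. -/
def approxRel {Γ : Type} [Group Γ] (g₁ g₂ : Γ) : Prop :=
  ∃ k : ℕ, g₂ = g₁ ^ k ∧ Nat.gcd k (orderOf g₁) = 1 ∧ k % 4 = 1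

/-- The traces of the powers of an endomorphism of finite order are power sums of roots of unity. -/
theorem exists_trace_pow_eq_sum {V : Type*} [AddCommGroup V] [Module ℂ V] [FiniteDimensional ℂ V]
    {T : Module.End ℂ V} {N : ℕ} (hN : N ≠ 0) (hT : T ^ N = 1) :
    ∃ (s : Finset ℂ) (m : ℂ → ℕ), (∀ μ ∈ s, μ ^ N = 1) ∧
      ∀ k : ℕ, LinearMap.trace ℂ V (T ^ k) = ∑ μ ∈ s, (m μ : ℂ) * μ ^ k := by
  have hss : T.IsSemisimple := by
    refine Module.End.isSemisimple_of_squarefree_aeval_eq_zero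
      (p := Polynomial.X ^ N - 1) ?_ (by simp [hT])
    exact ((Polynomial.X_pow_sub_one_separable_iff).2 (by exact_mod_cast hN)).squarefree
  have hint := DirectSum.isInternal_submodule_of_iSupIndep_of_iSup_eq_top
    T.eigenspaces_iSupIndep hss.iSup_eigenspace_eq_top
  have hfin : {μ | T.eigenspace μ ≠ ⊥}.Finite :=
    WellFoundedGT.finite_ne_bot_of_iSupIndep T.eigenspaces_iSupIndep
  have hpow (k : ℕ) (μ : ℂ) (v : V) (hv : v ∈ T.eigenspace μ) : (T ^ k) v = μ ^ k • v := by
    rw [Module.End.mem_eigenspace_iff] at hv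
    induction k with
    | zero => simp
    | succ k ih => rw [pow_succ, Module.End.mul_apply, hv, map_smul, ih, smul_smul, pow_succ']
  have hmaps (k : ℕ) (μ : ℂ) : Set.MapsTo (T ^ k) (T.eigenspace μ) (T.eigenspace μ) := by
    intro v hv
    rw [hpow k μ v hv]
    exact Submodule.smul_mem _ _ hv
  refine ⟨hfin.toFinset, fun μ => Module.finrank ℂ (T.eigenspace μ), fun μ hμ => ?_, fun k => ?_⟩
  · obtain ⟨v, hv, hv0⟩ := (Submodule.ne_bot_iff _).1 (hfin.mem_toFinset.1 hμ)
    have h := hpow N μ v hv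
    rw [hT, Module.End.one_apply] at h
    have : (μ ^ N - 1) • v = 0 := by rw [sub_smul, one_smul, ← h, sub_self]
    exact sub_eq_zero.1 ((smul_eq_zero.1 this).resolve_right hv0)
  · rw [LinearMap.trace_eq_sum_trace_restrict' hint hfin (hmaps k)]
    refine Finset.sum_congr rfl fun μ _ => ?_
    have : (T ^ k).restrict (hmaps k μ) = μ ^ k • LinearMap.id := by
      ext v
      exact hpow k μ v v.2
    rw [this]
    simp [mul_comm]

theorem FDRep.simple_of_isIrreducible {Γ V : Type} [Group Γ] [Fintype Γ] [AddCommGroup V]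
    [Module ℂ V] [FiniteDimensional ℂ V] (ρ : Representation ℂ Γ V) [ρ.IsIrreducible] :
    CategoryTheory.Simple (FDRep.of ρ) := by
  have hcard : (Nat.card Γ : ℂ) ≠ 0 := by exact_mod_cast Nat.card_pos.ne'
  have := invertibleOfNonzero hcard
  rw [FDRep.simple_iff_char_is_norm_one]
  have h := Representation.card_inv_mul_sum_char_mul_char_eq_finrank ρ ρ
  rw [Representation.IsIrreducible.finrank_intertwiningMap_self, Nat.cast_one,
    inv_mul_eq_one₀ hcard] at h
  exact h.symm

/-- Schur's lemma for a class function: if it is orthogonal to an irreducible character, it acts as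
zero on the representation. -/
theorem sum_smul_eq_zero_of_sum_character_eq_zero {Γ V : Type} [Group Γ] [Fintype Γ]
    [AddCommGroup V] [Module ℂ V] [FiniteDimensional ℂ V] (ρ : Representation ℂ Γ V)
    [ρ.IsIrreducible] {f : Γ → ℂ} (hf : ∀ x g, f (x * g * x⁻¹) = f g)
    (h : ∑ g, f g * ρ.character g = 0) : ∑ g, f g • ρ g = 0 := by
  let T : Representation.IntertwiningMap ρ ρ :=
    { toLinearMap := ∑ g, f g • ρ g
      isIntertwining' := fun x => by
        change (∑ g, f g • ρ g) * ρ x = ρ x * ∑ g, f g • ρ g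
        rw [Finset.sum_mul, Finset.mul_sum, ← (MulAut.conj x).toEquiv.sum_comp]
        refine Finset.sum_congr rfl fun g _ => ?_
        rw [smul_mul_assoc, mul_smul_comm, ← map_mul, ← map_mul]
        change f (x * g * x⁻¹) • ρ (x * g * x⁻¹ * x) = _
        rw [hf, inv_mul_cancel_right] }
  obtain ⟨a, ha⟩ :=
    (Representation.IsIrreducible.algebraMap_intertwiningMap_bijective_of_isAlgClosed (ρ := ρ)).2 T
  have hT : ∑ g, f g • ρ g = a • (1 : Module.End ℂ V) := by
    have := congrArg Representation.IntertwiningMap.toLinearMap ha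
    rw [Algebra.algebraMap_eq_smul_one] at this
    exact this.symm
  have htr := congrArg (LinearMap.trace ℂ V) hT
  have hV : Nontrivial V := by
    by_contra hV
    rw [not_nontrivial_iff_subsingleton] at hV
    have := Representation.IsIrreducible.finrank_intertwiningMap_self ρ
    have hs : Subsingleton (Representation.IntertwiningMap ρ ρ) :=
      ⟨fun f g => by ext v; exact Subsingleton.elim _ _⟩
    rw [Module.finrank_zero_of_subsingleton] at this
    exact zero_ne_one this
  have hd : (Module.finrank ℂ V : ℂ) ≠ 0 := by exact_mod_cast Module.finrank_pos.ne'
  have : a = 0 := by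
    simp only [map_sum, map_smul, LinearMap.trace_one, smul_eq_mul] at htr
    exact (mul_eq_zero.1 (htr.symm.trans h)).resolve_right hd
  rw [hT, this, zero_smul]

open scoped MonoidAlgebra in
/-- Completeness of the irreducible characters in the space of class functions. -/
theorem eq_zero_of_forall_sum_character_eq_zero {Γ : Type} [Group Γ] [Fintype Γ] {f : Γ → ℂ}
    (hf : ∀ x g, f (x * g * x⁻¹) = f g)
    (h : ∀ V : FDRep ℂ Γ, CategoryTheory.Simple V → ∑ g, f g * V.character g = 0) :
    f = 0 := by
  let z : ℂ[Γ] := ∑ g, f g • MonoidAlgebra.of ℂ Γ g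
  have hz (a : ℂ[Γ]) : z * a = a * z := by
    induction a using MonoidAlgebra.induction_on with
    | of x =>
      simp only [z]
      rw [Finset.sum_mul, Finset.mul_sum, ← (MulAut.conj x).toEquiv.sum_comp]
      refine Finset.sum_congr rfl fun g _ => ?_
      rw [smul_mul_assoc, mul_smul_comm, ← map_mul, ← map_mul]
      change f (x * g * x⁻¹) • MonoidAlgebra.of ℂ Γ (x * g * x⁻¹ * x) = _
      rw [hf, inv_mul_cancel_right]
    | add a b ha hb => rw [mul_add, add_mul, ha, hb]
    | smul r a ha => rw [mul_smul_comm, smul_mul_assoc, ha]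
  let K : Submodule ℂ[Γ] ℂ[Γ] :=
    { carrier := {m | z * m = 0}
      add_mem' := fun {a b} ha hb => by
        simp only [Set.mem_ofPred_eq] at *
        rw [mul_add, ha, hb, add_zero]
      zero_mem' := mul_zero z
      smul_mem' := fun a b hb => by
        simp only [Set.mem_ofPred_eq, smul_eq_mul] at *
        rw [← mul_assoc, hz, mul_assoc, hb, mul_zero] }
  have hK : K = ⊤ := by
    rw [eq_top_iff, ← IsSemisimpleModule.sSup_simples_eq_top ℂ[Γ] ℂ[Γ]]
    refine sSup_le fun S hS m hm => ?_
    have hS' : IsSimpleModule ℂ[Γ] S := hS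
    let ρ : Representation ℂ Γ S := Representation.ofModule' S
    have hρ (r : ℂ[Γ]) (v : S) : ρ.asAlgebraHom r v = r • v := by
      have : ρ.asAlgebraHom = Algebra.lsmul ℂ ℂ S :=
        (MonoidAlgebra.lift ℂ (Module.End ℂ S) Γ).apply_symm_apply _
      rw [this]
      rfl
    let e : ρ.asModule ≃ₗ[ℂ[Γ]] S :=
      { ρ.asModuleEquiv.toAddEquiv with
        map_smul' := fun r v => (ρ.asModuleEquiv_map_smul r v).trans (hρ r _) }
    have hirr : ρ.IsIrreducible := by
      rw [Representation.irreducible_iff_isSimpleModule_asModule]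
      exact IsSimpleModule.congr e
    have hfd : FiniteDimensional ℂ S := by
      have : FiniteDimensional ℂ ℂ[Γ] := inferInstance
      exact FiniteDimensional.finiteDimensional_submodule (S.restrictScalars ℂ)
    have h0 := sum_smul_eq_zero_of_sum_character_eq_zero ρ hf
      (h _ (FDRep.simple_of_isIrreducible ρ))
    have hzρ : ρ.asAlgebraHom z = 0 := by
      rw [← h0]
      simp [z, Representation.asAlgebraHom_single]
    have h1 : z • (⟨m, hm⟩ : S) = 0 := by
      rw [← hρ, hzρ, LinearMap.zero_apply]
    exact congrArg Subtype.val h1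
  have hz0 : z = 0 := by
    have : (1 : ℂ[Γ]) ∈ K := hK ▸ Submodule.mem_top
    simpa using (show z * 1 = 0 from this)
  funext g
  have hlin := (MonoidAlgebra.basis Γ ℂ).linearIndependent
  simpa using Fintype.linearIndependent_iff.1 hlin f (by simpa [z] using hz0) g

/-- An integral combination of `N`-th roots of unity is an integer if and only if it is fixed by all
the Galois conjugations `w ↦ w ^ k`. -/
theorem exists_intCast_eq_sum_iff_forall_coprime {ι : Type*} (t : Finset ι) (a : ι → ℤ) (w : ι → ℂ)
    {N : ℕ} [NeZero N] (hw : ∀ i ∈ t, w i ^ N = 1) :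
    (∃ n : ℤ, ∑ i ∈ t, (a i : ℂ) * w i = n) ↔
      ∀ k : ℕ, k.Coprime N → ∑ i ∈ t, (a i : ℂ) * w i ^ k = ∑ i ∈ t, (a i : ℂ) * w i := by
  obtain ⟨K, _, _, _⟩ :
      ∃ (K : Type) (_ : Field K) (_ : Algebra ℚ K), IsCyclotomicExtension {N} ℚ K :=
    ⟨CyclotomicField N ℚ, inferInstance, CyclotomicField.algebra N ℚ,
      CyclotomicField.isCyclotomicExtension N ℚ⟩
  have : IsGalois ℚ K := IsCyclotomicExtension.isGalois {N} ℚ K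
  have : FiniteDimensional ℚ K := IsCyclotomicExtension.finiteDimensional {N} ℚ K
  have : CharZero K := algebraRat.charZero K
  let ζ : K := IsCyclotomicExtension.zeta N ℚ K
  have hζ : IsPrimitiveRoot ζ N := IsCyclotomicExtension.zeta_spec N ℚ K
  let f : K →ₐ[ℚ] ℂ := IsAlgClosed.lift
  have hf : Function.Injective f := f.toRingHom.injective
  have hfζ : IsPrimitiveRoot (f ζ) N := hζ.map_of_injective hf
  have hex (i : ι) : ∃ j : ℕ, i ∈ t → f ζ ^ j = w i := by
    by_cases hi : i ∈ t
    · obtain ⟨j, -, hj⟩ := hfζ.eq_pow_of_pow_eq_one (hw i hi)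
      exact ⟨j, fun _ => hj⟩
    · exact ⟨0, fun h => absurd h hi⟩
  choose j hj using hex
  let x : K := ∑ i ∈ t, (a i : K) * ζ ^ j i
  have hfx : f x = ∑ i ∈ t, (a i : ℂ) * w i := by
    simp only [x, map_sum, map_mul, map_pow, map_intCast]
    exact Finset.sum_congr rfl fun i hi => by rw [hj i hi]
  have hσx (σ : Gal(K/ℚ)) (k : ℕ) (hσ : σ ζ = ζ ^ k) :
      f (σ x) = ∑ i ∈ t, (a i : ℂ) * w i ^ k := by
    simp only [x, map_sum, map_mul, map_pow, map_intCast, hσ]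
    exact Finset.sum_congr rfl fun i hi => by rw [← hj i hi, pow_right_comm]
  have hpow (σ : Gal(K/ℚ)) : σ ζ = ζ ^ ((hζ.autToPow ℚ σ : (ZMod N)ˣ) : ZMod N).val :=
    (hζ.autToPow_spec ℚ σ).symm
  constructor
  · rintro ⟨n, hn⟩ k hk
    let σ : Gal(K/ℚ) := (IsCyclotomicExtension.autEquivPow K
      (Polynomial.cyclotomic.irreducible_rat (NeZero.pos N))).symm (ZMod.unitOfCoprime k hk)
    have hσ : σ ζ = ζ ^ k := by
      have h1 : hζ.autToPow ℚ σ = ZMod.unitOfCoprime k hk :=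
        (IsCyclotomicExtension.autEquivPow K _).apply_symm_apply _
      rw [hpow, h1, ZMod.coe_unitOfCoprime, ZMod.val_natCast]
      conv_rhs =>
        rw [← Nat.mod_add_div k N, pow_add, pow_mul, hζ.pow_eq_one, one_pow, mul_one]
    have hx : x = (n : K) := hf (by rw [hfx, hn, map_intCast])
    rw [← hσx σ k hσ, ← hfx, hx, map_intCast]
  · intro h
    have hfix : ∀ σ : Gal(K/ℚ), σ x = x := fun σ => hf <| by
      rw [hσx σ _ (hpow σ), h _ (ZMod.val_coe_unit_coprime _), hfx]
    obtain ⟨q, hq⟩ := IntermediateField.mem_bot.1 ((IsGalois.mem_bot_iff_fixed x).2 hfix)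
    have hint : IsIntegral ℤ x := by
      refine IsIntegral.sum _ fun i _ => ?_
      exact (isIntegral_algebraMap (R := ℤ) (A := K)).mul
        ((hζ.isIntegral (NeZero.pos N)).pow _)
    rw [← hq, isIntegral_algebraMap_iff (algebraMap ℚ K).injective] at hint
    obtain ⟨n, hn⟩ := IsIntegrallyClosed.isIntegral_iff.1 hint
    refine ⟨n, ?_⟩
    rw [← hfx, ← hq, ← hn]
    simp

theorem sum_conj_eq_card_mul_conjClassSum {Γ : Type} [Group Γ] [Fintype Γ] (c : Γ → ℤ) (g : Γ) :
    ∑ x : Γ, c (x * g * x⁻¹) =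
      (Finset.univ.filter fun x : Γ => x * g * x⁻¹ = g).card * conjClassSum c g := by
  rw [conjClassSum, Finset.mul_sum, ← Finset.sum_fiberwise_of_maps_to
    (g := fun x => x * g * x⁻¹) (t := Finset.univ.filter fun s => IsConj g s)
    (fun x _ => by simp [isConj_iff])]
  refine Finset.sum_congr rfl fun s hs => ?_
  obtain ⟨y, rfl⟩ := isConj_iff.1 (Finset.mem_filter.1 hs).2
  rw [Finset.sum_congr rfl fun x hx => by rw [(Finset.mem_filter.1 hx).2], Finset.sum_const,
    nsmul_eq_mul]
  congr 2
  refine Finset.card_equiv (Equiv.mulLeft y⁻¹) fun x => ?_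
  simp only [Finset.mem_filter, Finset.mem_univ, true_and, Equiv.coe_mulLeft]
  constructor
  · intro h
    rw [mul_inv_rev, inv_inv, show y⁻¹ * x * g * (x⁻¹ * y) = y⁻¹ * (x * g * x⁻¹) * y by group, h]
    group
  · intro h
    calc x * g * x⁻¹ = y * (y⁻¹ * x * g * (y⁻¹ * x)⁻¹) * y⁻¹ := by group
      _ = y * g * y⁻¹ := by rw [h]

theorem sum_mul_eq_zero_of_conjClassSum_eq_zero {Γ : Type} [Group Γ] [Fintype Γ] {c : Γ → ℤ}
    (hc : ∀ g, conjClassSum c g = 0) {φ : Γ → ℂ} (hφ : ∀ x g, φ (x * g * x⁻¹) = φ g) :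
    ∑ g, (c g : ℂ) * φ g = 0 := by
  have hcard : (Fintype.card Γ : ℂ) ≠ 0 := by exact_mod_cast Fintype.card_ne_zero
  refine (mul_eq_zero.1 ?_).resolve_left hcard
  calc (Fintype.card Γ : ℂ) * ∑ g, (c g : ℂ) * φ g
      = ∑ x : Γ, ∑ g, (c (x * g * x⁻¹) : ℂ) * φ g := by
        rw [← nsmul_eq_mul, ← Finset.card_univ, ← Finset.sum_const]
        refine Finset.sum_congr rfl fun x _ => ?_
        rw [← (MulAut.conj x).toEquiv.sum_comp]
        exact Finset.sum_congr rfl fun g _ => by simp [hφ]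
    _ = ∑ g, ((∑ x : Γ, c (x * g * x⁻¹) : ℤ) : ℂ) * φ g := by
        rw [Finset.sum_comm]
        simp [Finset.sum_mul]
    _ = 0 := by simp [sum_conj_eq_card_mul_conjClassSum, hc]

theorem conjClassSum_eq_zero_of_forall_sum_character_eq_zero {Γ : Type} [Group Γ] [Fintype Γ]
    {c : Γ → ℤ}
    (h : ∀ V : FDRep ℂ Γ, CategoryTheory.Simple V → ∑ g, (c g : ℂ) * V.character g = 0) (g : Γ) :
    conjClassSum c g = 0 := by
  have key := eq_zero_of_forall_sum_character_eq_zero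
    (f := fun g => ((∑ x : Γ, c (x * g * x⁻¹) : ℤ) : ℂ)) ?_ ?_
  · have hg : ∑ x : Γ, c (x * g * x⁻¹) = 0 := by
      simpa only [Pi.zero_apply, Int.cast_eq_zero] using congrFun key g
    rw [sum_conj_eq_card_mul_conjClassSum] at hg
    refine (mul_eq_zero.1 hg).resolve_left ?_
    exact_mod_cast Finset.card_ne_zero_of_mem (a := (1 : Γ)) (by simp)
  · intro y g
    congr 1
    rw [← Equiv.sum_comp (Equiv.mulRight y) fun x => c (x * g * x⁻¹)]
    exact Finset.sum_congr rfl fun x _ => by simp [mul_assoc]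
  · intro V hV
    push_cast
    simp_rw [Finset.sum_mul]
    rw [Finset.sum_comm]
    refine Finset.sum_eq_zero fun x _ => ?_
    rw [← h V hV, ← (MulAut.conj x).toEquiv.sum_comp fun g => (c g : ℂ) * V.character g]
    exact Finset.sum_congr rfl fun g _ => by simp

theorem exists_int_sum_I_mul_character_iff {Γ : Type} [Group Γ] [Fintype Γ] (c : Γ → ℤ)
    (V : FDRep ℂ Γ) :
    (∃ n : ℤ, ∑ g, Complex.I * (c g : ℂ) * V.character g = n) ↔
      ∀ k : ℕ, k.Coprime (4 * Fintype.card Γ) →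
        ∑ g, Complex.I ^ k * (c g : ℂ) * V.character (g ^ k) =
          ∑ g, Complex.I * (c g : ℂ) * V.character g := by
  have hcard : Fintype.card Γ ≠ 0 := Fintype.card_ne_zero
  have : NeZero (4 * Fintype.card Γ) := ⟨by positivity⟩
  have hpow (g : Γ) : V.ρ g ^ Fintype.card Γ = 1 := by
    rw [← map_pow, pow_card_eq_one, map_one]
  choose s m hs hm using fun g => exists_trace_pow_eq_sum hcard (hpow g)
  have hsum (k : ℕ) : ∑ g, Complex.I ^ k * (c g : ℂ) * V.character (g ^ k) =
      ∑ p ∈ Finset.univ.sigma s, ((c p.1 * m p.1 p.2 : ℤ) : ℂ) * (Complex.I * p.2) ^ k := by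
    rw [Finset.sum_sigma]
    refine Finset.sum_congr rfl fun g _ => ?_
    rw [FDRep.character, map_pow, hm, Finset.mul_sum]
    refine Finset.sum_congr rfl fun μ _ => ?_
    push_cast
    ring
  have hone : ∑ g, Complex.I * (c g : ℂ) * V.character g =
      ∑ p ∈ Finset.univ.sigma s, ((c p.1 * m p.1 p.2 : ℤ) : ℂ) * (Complex.I * p.2) := by
    simpa only [pow_one] using hsum 1
  simp_rw [hsum, hone]
  refine exists_intCast_eq_sum_iff_forall_coprime (N := 4 * Fintype.card Γ) _ _ _ ?_
  rintro ⟨g, μ⟩ hμ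
  rw [mul_pow, pow_mul, Complex.I_pow_four, one_pow, one_mul, mul_comm, pow_mul,
    hs g μ (Finset.mem_sigma.1 hμ).2, one_pow]

theorem IsConj.pow_iff_of_coprime_card {Γ : Type*} [Group Γ] {k : ℕ}
    (hk : (Nat.card Γ).Coprime k) {g h : Γ} : IsConj (g ^ k) (h ^ k) ↔ IsConj g h := by
  simp only [isConj_iff, ← conj_pow]
  exact exists_congr fun x => (powCoprime hk).injective.eq_iff

theorem conjClassSum_comp_powCoprime_symm {Γ : Type} [Group Γ] [Fintype Γ] (c : Γ → ℤ) {k : ℕ}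
    (hk : (Nat.card Γ).Coprime k) (g : Γ) :
    conjClassSum (fun x => c ((powCoprime hk).symm x)) (g ^ k) = conjClassSum c g := by
  refine (Finset.sum_equiv (powCoprime hk) (fun x => ?_) fun x _ => ?_).symm
  · simp only [Finset.mem_filter, Finset.mem_univ, true_and]
    exact (IsConj.pow_iff_of_coprime_card hk).symm
  · rw [Equiv.symm_apply_apply]

theorem forall_exists_int_iff_conjClassSum_pow {Γ : Type} [Group Γ] [Fintype Γ] (c : Γ → ℤ) :
    (∀ V : FDRep ℂ Γ, CategoryTheory.Simple V →
        ∃ n : ℤ, ∑ g, Complex.I * (c g : ℂ) * V.character g = n) ↔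
      ∀ k : ℕ, k.Coprime (4 * Fintype.card Γ) → ∀ g,
        conjClassSum c (g ^ k) = ZMod.χ₄ k * conjClassSum c g := by
  simp_rw [exists_int_sum_I_mul_character_iff]
  have hI (k : ℕ) (hk : k.Coprime (4 * Fintype.card Γ)) :
      Complex.I ^ k = Complex.I * ((ZMod.χ₄ k : ℤ) : ℂ) := by
    have h2 : k % 2 = 1 := by
      have := (Nat.Coprime.coprime_mul_right_right hk).coprime_dvd_right (show 2 ∣ 4 by norm_num)
      exact Nat.odd_iff.1 (Nat.coprime_two_right.1 this)
    rw [ZMod.χ₄_nat_eq_if_mod_four, if_neg (by omega), Complex.I_pow_eq_pow_mod]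
    obtain h | h : k % 4 = 1 ∨ k % 4 = 3 := by omega
    · simp [h]
    · simp [h, Complex.I_pow_three]
  have hcop {k : ℕ} (hk : k.Coprime (4 * Fintype.card Γ)) : (Nat.card Γ).Coprime k := by
    rw [Nat.card_eq_fintype_card]
    exact (Nat.Coprime.coprime_mul_left_right hk).symm
  -- the defect of the required identity, as a function on the group
  let d {k : ℕ} (hk : k.Coprime (4 * Fintype.card Γ)) (g : Γ) : ℤ :=
    ZMod.χ₄ k * c ((powCoprime (hcop hk)).symm g) - c g
  have hd {k : ℕ} (hk : k.Coprime (4 * Fintype.card Γ)) (g : Γ) :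
      conjClassSum (d hk) (g ^ k) = ZMod.χ₄ k * conjClassSum c g - conjClassSum c (g ^ k) := by
    rw [← conjClassSum_comp_powCoprime_symm c (hcop hk) g]
    simp only [d, conjClassSum, Finset.sum_sub_distrib, Finset.mul_sum]
  have hdχ {k : ℕ} (hk : k.Coprime (4 * Fintype.card Γ)) (V : FDRep ℂ Γ) :
      Complex.I * ∑ g, (d hk g : ℂ) * V.character g =
        ∑ g, Complex.I ^ k * (c g : ℂ) * V.character (g ^ k) -
          ∑ g, Complex.I * (c g : ℂ) * V.character g := by
    have h1 : ∑ g, Complex.I ^ k * (c g : ℂ) * V.character (g ^ k) =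
        ∑ g, Complex.I ^ k * (c ((powCoprime (hcop hk)).symm g) : ℂ) * V.character g := by
      rw [← (powCoprime (hcop hk)).sum_comp fun g =>
        Complex.I ^ k * (c ((powCoprime (hcop hk)).symm g) : ℂ) * V.character g]
      exact Finset.sum_congr rfl fun g _ => by rw [Equiv.symm_apply_apply]; rfl
    rw [h1, hI k hk, Finset.mul_sum, ← Finset.sum_sub_distrib]
    refine Finset.sum_congr rfl fun g _ => ?_
    simp only [d]
    push_cast
    ring
  constructor
  · intro h k hk g
    refine (sub_eq_zero.1 ?_).symm
    rw [← hd hk]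
    refine conjClassSum_eq_zero_of_forall_sum_character_eq_zero (fun V hV => ?_) _
    refine (mul_eq_zero.1 ?_).resolve_left Complex.I_ne_zero
    rw [hdχ hk V, h V hV k hk, sub_self]
  · intro h V _ k hk
    rw [← sub_eq_zero, ← hdχ hk V, sum_mul_eq_zero_of_conjClassSum_eq_zero (fun g => ?_)
      (fun x g => V.char_conj g x), mul_zero]
    obtain ⟨g, rfl⟩ := (powCoprime (hcop hk)).surjective g
    exact (hd hk g).trans (sub_eq_zero.2 (h k hk g).symm)

/-- A unit modulo a divisor of `N` lifts to a unit modulo `N`. -/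
theorem Nat.Coprime.exists_modEq_coprime {k n N : ℕ} [NeZero N] (hk : k.Coprime n) (hn : n ∣ N) :
    ∃ l : ℕ, l ≡ k [MOD n] ∧ l.Coprime N := by
  obtain ⟨u, hu⟩ := ZMod.unitsMap_surjective hn (ZMod.unitOfCoprime k hk)
  refine ⟨(u : ZMod N).val, ?_, ZMod.val_coe_unit_coprime u⟩
  rw [← ZMod.natCast_eq_natCast_iff, ← ZMod.coe_unitOfCoprime k hk, ← hu, ZMod.unitsMap_val,
    ZMod.natCast_val]

/-- Equivariance of the class sums under power maps, twisted by the character modulo `4`, unpacked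
into conditions (i)-(iii). -/
theorem conjClassSum_pow_iff {Γ : Type} [Group Γ] [Fintype Γ] (c : Γ → ℤ) :
    (∀ k : ℕ, k.Coprime (4 * Fintype.card Γ) → ∀ g,
        conjClassSum c (g ^ k) = ZMod.χ₄ k * conjClassSum c g) ↔
      ((∀ g₁ g₂ : Γ, 4 ∣ orderOf g₁ → 4 ∣ orderOf g₂ → approxRel g₁ g₂ →
            conjClassSum c g₁ = conjClassSum c g₂)
        ∧ (∀ g : Γ, conjClassSum c g = - conjClassSum c g⁻¹)
        ∧ (∀ g : Γ, ¬ (4 ∣ orderOf g) → conjClassSum c g = 0)) := by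
  have hcard : 0 < Fintype.card Γ := Fintype.card_pos
  have : NeZero (4 * Fintype.card Γ) := ⟨by positivity⟩
  constructor
  · intro h
    refine ⟨?_, fun g => ?_, fun g hg => ?_⟩
    · rintro g₁ _ h₁ - ⟨k, rfl, hk, hk4⟩
      obtain ⟨l, hlk, hl⟩ := Nat.Coprime.exists_modEq_coprime hk
        ((orderOf_dvd_card (x := g₁)).trans (Dvd.intro_left 4 rfl))
      have hl4 : l % 4 = 1 := Eq.trans (hlk.of_dvd h₁) hk4
      rw [← pow_eq_pow_iff_modEq.2 hlk, h l hl, ZMod.χ₄_nat_one_mod_four hl4, one_mul]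
    · have hinv : g ^ (4 * Fintype.card Γ - 1) = g⁻¹ := by
        rw [eq_inv_iff_mul_eq_one, ← pow_succ, Nat.sub_add_cancel (by omega), mul_comm, pow_mul,
          pow_card_eq_one, one_pow]
      have hcop : (4 * Fintype.card Γ - 1).Coprime (4 * Fintype.card Γ) :=
        (Nat.coprime_self_sub_left (by omega)).2 (Nat.coprime_one_left _)
      rw [← hinv, h _ hcop, ZMod.χ₄_nat_three_mod_four (by omega)]
      ring
    · -- a unit that is `1` modulo the order of `g` and `3` modulo `4`
      obtain ⟨m, hm, hr⟩ : ∃ m, m % 2 = 1 ∧ (orderOf g = m ∨ orderOf g = 2 * m) := by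
        by_cases h2 : orderOf g % 2 = 1
        · exact ⟨_, h2, Or.inl rfl⟩
        · exact ⟨orderOf g / 2, by omega, Or.inr (by omega)⟩
      have hdvd : 4 * m ∣ 4 * Fintype.card Γ := by
        refine mul_dvd_mul_left 4 (dvd_trans ?_ (orderOf_dvd_card (x := g)))
        obtain hr | hr := hr <;> simp [hr]
      have hcop : (1 + 2 * m).Coprime (4 * m) := by
        refine Nat.Coprime.mul_right ?_ (by simp)
        exact (show (4 : ℕ) = 2 ^ 2 by norm_num) ▸ Nat.Coprime.pow_right 2 (by simp)
      obtain ⟨l, hlk, hl⟩ := hcop.exists_modEq_coprime hdvd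
      have hl4 : l % 4 = 3 := by
        have : l % 4 = (1 + 2 * m) % 4 := hlk.of_dvd (Dvd.intro m rfl)
        omega
      have hlg : l ≡ 1 [MOD orderOf g] := by
        have h2m : l ≡ 1 [MOD 2 * m] :=
          (hlk.of_dvd ⟨2, by ring⟩).trans (by simp [Nat.ModEq])
        refine h2m.of_dvd ?_
        obtain hr | hr := hr <;> simp [hr]
      have hgl : g ^ l = g := by rw [pow_eq_pow_iff_modEq.2 hlg, pow_one]
      have := h l hl g
      rw [hgl, ZMod.χ₄_nat_three_mod_four hl4] at this
      omega
  · rintro ⟨h₁, h₂, h₃⟩ k hk g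
    have hcop {k : ℕ} (hk : k.Coprime (4 * Fintype.card Γ)) : (orderOf g).Coprime k :=
      (hk.coprime_dvd_right ((orderOf_dvd_card (x := g)).trans (Dvd.intro_left 4 rfl))).symm
    by_cases hg : 4 ∣ orderOf g
    · have key {l : ℕ} (hl : l.Coprime (4 * Fintype.card Γ)) (hl4 : l % 4 = 1) :
          conjClassSum c g = conjClassSum c (g ^ l) :=
        h₁ g _ hg (by rwa [(hcop hl).orderOf_pow]) ⟨l, rfl, (hcop hl).symm, hl4⟩
      have hk4 : k % 4 = 1 ∨ k % 4 = 3 := by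
        have := (Nat.Coprime.coprime_mul_right_right hk).coprime_dvd_right
          (show 2 ∣ 4 by norm_num)
        have := Nat.odd_iff.1 (Nat.coprime_two_right.1 this)
        omega
      obtain hk4 | hk4 := hk4
      · rw [← key hk hk4, ZMod.χ₄_nat_one_mod_four hk4, one_mul]
      · have hinv : (g ^ k)⁻¹ = g ^ (k * (4 * Fintype.card Γ - 1)) := by
          rw [inv_eq_iff_mul_eq_one, ← pow_add,
            show k + k * (4 * Fintype.card Γ - 1) = Fintype.card Γ * (4 * k) by
              obtain ⟨n, hn⟩ := Nat.exists_eq_succ_of_ne_zero hcard.ne'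
              rw [hn, show 4 * n.succ - 1 = 4 * n + 3 by omega, Nat.succ_eq_add_one]
              ring,
            pow_mul, pow_card_eq_one, one_pow]
        have hcop' : (4 * Fintype.card Γ - 1).Coprime (4 * Fintype.card Γ) :=
          (Nat.coprime_self_sub_left (by omega)).2 (Nat.coprime_one_left _)
        rw [h₂ (g ^ k), hinv, ← key (Nat.Coprime.mul_left hk hcop')
          (by rw [Nat.mul_mod, hk4, show (4 * Fintype.card Γ - 1) % 4 = 3 by omega]),
          ZMod.χ₄_nat_three_mod_four hk4]
        ring
    · rw [h₃ g hg, h₃ (g ^ k) (by rwa [(hcop hk).orderOf_pow]), mul_zero]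

/-- For `c : Γ → ℤ`, the sum `Σ_g i·c(g)·χ(g)` is an integer for every irreducible complex
character `χ` of `Γ` if and only if:
(i) conjugacy class sums of `c` agree on `≈`-equivalent elements of `Γ(4)`,
(ii) the class sum at `g` is the negative of the class sum at `g⁻¹`, and
(iii) the class sum vanishes outside `Γ(4)`. -/
theorem integral_character_sum_iff
    (Γ : Type) [Group Γ] [Fintype Γ] (c : Γ → ℤ) :
    (∀ V : FDRep ℂ Γ, CategoryTheory.Simple V →
        ∃ k : ℤ, (∑ g : Γ, Complex.I * (c g : ℂ) * V.character g) = (k : ℂ))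
      ↔ ((∀ g₁ g₂ : Γ, 4 ∣ orderOf g₁ → 4 ∣ orderOf g₂ → approxRel g₁ g₂ →
            conjClassSum c g₁ = conjClassSum c g₂)
        ∧ (∀ g : Γ, conjClassSum c g = - conjClassSum c g⁻¹)
        ∧ (∀ g : Γ, ¬ (4 ∣ orderOf g) → conjClassSum c g = 0)) := by
  exact (forall_exists_int_iff_conjClassSum_pow c).trans (conjClassSum_pow_iff c)
end
end

section
/- Let Γ be a finite group, S ⊆ Γ with 1 ∉ S, and S a union of conjugacy classes of Γ (so Cay(Γ,S) is a normal mixed Cayley graph). Then Cay(Γ,S) is H-integral if and only if S∖S̄ ∈ B(Γ) and S̄ ∈ D(Γ); concretely, if and only if [x] ⊆ S∖S̄ for every x ∈ S∖S̄, and S̄ ⊆ Γ(4) with ⟦x⟧ ⊆ S̄ for every x ∈ S̄. -/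
open scoped Classical

noncomputable section

/-- The Hermitian adjacency matrix of the mixed Cayley graph `Cay(Γ, S)`. -/
def hermitianAdjMatrix {Γ : Type} [Group Γ] [Fintype Γ] [DecidableEq Γ]
    (S : Finset Γ) : Matrix Γ Γ ℂ :=
  Matrix.of fun a b =>
    if b * a⁻¹ ∈ S then (if a * b⁻¹ ∈ S then 1 else Complex.I)
    else (if a * b⁻¹ ∈ S then -Complex.I else 0)

/-- A matrix is H-integral if all of its eigenvalues are integers. -/
def MatrixIntegral {Γ : Type} [Fintype Γ] [DecidableEq Γ] (M : Matrix Γ Γ ℂ) : Prop :=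
  ∀ z ∈ spectrum ℂ M, ∃ k : ℤ, z = (k : ℂ)

/-- `[x] = {y : ⟨y⟩ = ⟨x⟩}`, the atom of the Boolean algebra `B(Γ)` containing `x`. -/
def atom1 {Γ : Type} [Group Γ] (x : Γ) : Set Γ :=
  {y | Subgroup.zpowers y = Subgroup.zpowers x}

/-- `⟦x⟧ = {x^k : 1 ≤ k ≤ ord(x)−1, gcd(k, ord(x)) = 1, k ≡ 1 (mod 4)}`. -/
def bracket4 {Γ : Type} [Group Γ] (x : Γ) : Set Γ :=
  {y | ∃ k : ℕ, 1 ≤ k ∧ k ≤ orderOf x - 1 ∧ Nat.gcd k (orderOf x) = 1 ∧ k % 4 = 1 ∧ y = x ^ k}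

section GaloisGraph

variable (N : ℕ) [NeZero N]

instance isCyclotomicExtension_toRatAlgebra :
    IsCyclotomicExtension {N} ℚ (CyclotomicField N ℚ) := by
  convert! CyclotomicField.isCyclotomicExtension N ℚ

/-- A fixed embedding of the `N`-th cyclotomic field into `ℂ`. -/
def cyclotomicEmbedding : CyclotomicField N ℚ →ₐ[ℚ] ℂ :=
  IsAlgClosed.lift

/-- The graph of a Galois automorphism of the `N`-th cyclotomic field, inside `ℂ × ℂ`. -/
def galoisGraph (σ : Gal(CyclotomicField N ℚ/ℚ)) : Subalgebra ℚ (ℂ × ℂ) :=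
  ((cyclotomicEmbedding N).prod ((cyclotomicEmbedding N).comp (σ : _ →ₐ[ℚ] _))).range

variable {N}

omit [NeZero N] in
lemma mem_galoisGraph {σ : Gal(CyclotomicField N ℚ/ℚ)} {z w : ℂ} :
    (z, w) ∈ galoisGraph N σ ↔
      ∃ c, cyclotomicEmbedding N c = z ∧ cyclotomicEmbedding N (σ c) = w := by
  simp [galoisGraph]

omit [NeZero N] in
lemma galoisGraph_functional {σ : Gal(CyclotomicField N ℚ/ℚ)} {z w w' : ℂ}
    (h : (z, w) ∈ galoisGraph N σ) (h' : (z, w') ∈ galoisGraph N σ) : w = w' := by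
  obtain ⟨c, hc, rfl⟩ := mem_galoisGraph.1 h
  obtain ⟨d, hd, rfl⟩ := mem_galoisGraph.1 h'
  rw [(cyclotomicEmbedding N).injective (hc.trans hd.symm)]

lemma root_pow_mem_galoisGraph {σ : Gal(CyclotomicField N ℚ/ℚ)} {k : ℕ}
    (hσ : σ (IsCyclotomicExtension.zeta N ℚ _) = IsCyclotomicExtension.zeta N ℚ _ ^ k)
    {μ : ℂ} (hμ : μ ^ N = 1) : (μ, μ ^ k) ∈ galoisGraph N σ := by
  have hζ : IsPrimitiveRoot (cyclotomicEmbedding N (IsCyclotomicExtension.zeta N ℚ _)) N :=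
    (IsCyclotomicExtension.zeta_spec N ℚ _).map_of_injective (cyclotomicEmbedding N).injective
  obtain ⟨i, -, rfl⟩ := hζ.eq_pow_of_pow_eq_one hμ
  refine mem_galoisGraph.2 ⟨IsCyclotomicExtension.zeta N ℚ _ ^ i, map_pow _ _ _, ?_⟩
  rw [map_pow, hσ, map_pow, map_pow, ← pow_mul, ← pow_mul, mul_comm]

lemma exists_galois_of_coprime {k : ℕ} (hk : k.Coprime N) :
    ∃ σ : Gal(CyclotomicField N ℚ/ℚ),
      σ (IsCyclotomicExtension.zeta N ℚ _) = IsCyclotomicExtension.zeta N ℚ _ ^ k :=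
  ⟨_, IsCyclotomicExtension.fromZetaAut_spec
    ((IsCyclotomicExtension.zeta_spec N ℚ (CyclotomicField N ℚ)).pow_of_coprime k hk)
    (Polynomial.cyclotomic.irreducible_rat (NeZero.pos N))⟩

lemma exists_coprime_of_galois (σ : Gal(CyclotomicField N ℚ/ℚ)) :
    ∃ k : ℕ, k.Coprime N ∧
      σ (IsCyclotomicExtension.zeta N ℚ _) = IsCyclotomicExtension.zeta N ℚ _ ^ k := by
  have hζ := IsCyclotomicExtension.zeta_spec N ℚ (CyclotomicField N ℚ)
  exact ⟨_, ZMod.val_coe_unit_coprime (hζ.autToPow ℚ σ), (hζ.autToPow_spec ℚ σ).symm⟩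

lemma exists_rat_of_galoisGraph_diag {z : ℂ}
    (h : ∀ σ : Gal(CyclotomicField N ℚ/ℚ), (z, z) ∈ galoisGraph N σ) : ∃ q : ℚ, z = q := by
  obtain ⟨c, rfl, -⟩ := mem_galoisGraph.1 (h 1)
  have : IsGalois ℚ (CyclotomicField N ℚ) := IsCyclotomicExtension.isGalois {N} ℚ _
  have : FiniteDimensional ℚ (CyclotomicField N ℚ) :=
    IsCyclotomicExtension.finiteDimensional {N} ℚ _
  have hc : c ∈ (⊥ : IntermediateField ℚ (CyclotomicField N ℚ)) := by
    rw [IsGalois.mem_bot_iff_fixed]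
    intro σ
    obtain ⟨d, hd, hσ⟩ := mem_galoisGraph.1 (h σ)
    rw [(cyclotomicEmbedding N).injective hd] at hσ
    exact (cyclotomicEmbedding N).injective hσ
  obtain ⟨q, rfl⟩ := IntermediateField.mem_bot.1 hc
  exact ⟨q, by simp⟩

omit [NeZero N] in
lemma ratCast_mem_galoisGraph {σ : Gal(CyclotomicField N ℚ/ℚ)} (q : ℚ) :
    ((q : ℂ), (q : ℂ)) ∈ galoisGraph N σ :=
  mem_galoisGraph.2 ⟨algebraMap ℚ _ q, by simp, by simp⟩

omit [NeZero N] in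
lemma natCast_mem_galoisGraph {σ : Gal(CyclotomicField N ℚ/ℚ)} (n : ℕ) :
    ((n : ℂ), (n : ℂ)) ∈ galoisGraph N σ := by
  exact_mod_cast ratCast_mem_galoisGraph (σ := σ) n

omit [NeZero N] in
lemma neg_mem_galoisGraph {σ : Gal(CyclotomicField N ℚ/ℚ)} {a b : ℂ}
    (h : (a, b) ∈ galoisGraph N σ) : (-a, -b) ∈ galoisGraph N σ :=
  neg_mem h

omit [NeZero N] in
lemma mul_mem_galoisGraph {σ : Gal(CyclotomicField N ℚ/ℚ)} {a b a' b' : ℂ}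
    (h : (a, b) ∈ galoisGraph N σ) (h' : (a', b') ∈ galoisGraph N σ) :
    (a * a', b * b') ∈ galoisGraph N σ :=
  mul_mem h h'

omit [NeZero N] in
lemma sum_mem_galoisGraph {σ : Gal(CyclotomicField N ℚ/ℚ)} {ι : Type*} {s : Finset ι}
    {a b : ι → ℂ} (h : ∀ i ∈ s, (a i, b i) ∈ galoisGraph N σ) :
    (∑ i ∈ s, a i, ∑ i ∈ s, b i) ∈ galoisGraph N σ := by
  rw [show (∑ i ∈ s, a i, ∑ i ∈ s, b i) = ∑ i ∈ s, (a i, b i) by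
    simp [Prod.ext_iff, Prod.fst_sum, Prod.snd_sum]]
  exact sum_mem h

end GaloisGraph

section Trace

open Module LinearMap

variable {V : Type*} [AddCommGroup V] [Module ℂ V] [FiniteDimensional ℂ V]

lemma finite_maxGenEigenspace_ne_bot (f : End ℂ V) : {μ | f.maxGenEigenspace μ ≠ ⊥}.Finite :=
  WellFoundedGT.finite_ne_bot_of_iSupIndep f.independent_maxGenEigenspace

lemma trace_eq_sum_trace_restrict_maxGenEigenspace {f g : End ℂ V} (h : Commute f g) :
    trace ℂ V g = ∑ μ ∈ (finite_maxGenEigenspace_ne_bot f).toFinset,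
      trace ℂ _ (g.restrict (f.mapsTo_maxGenEigenspace_of_comm h μ)) :=
  trace_eq_sum_trace_restrict' (DirectSum.isInternal_submodule_of_iSupIndep_of_iSup_eq_top
    f.independent_maxGenEigenspace f.iSup_maxGenEigenspace_eq_top) _ _

lemma trace_restrict_maxGenEigenspace_mul {f g : End ℂ V} (h : Commute f g) (μ : ℂ) :
    trace ℂ _ ((g * f).restrict
        (f.mapsTo_maxGenEigenspace_of_comm (h.mul_right (Commute.refl f)) μ)) =
      μ * trace ℂ _ (g.restrict (f.mapsTo_maxGenEigenspace_of_comm h μ)) := by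
  have hf := f.mapsTo_maxGenEigenspace_of_comm (Commute.refl _) μ
  have hg := f.mapsTo_maxGenEigenspace_of_comm h μ
  exact trace_comp_eq_mul_of_commute_of_isNilpotent μ (restrict_commute h.symm hg hf)
    (f.isNilpotent_restrict_maxGenEigenspace_sub_algebraMap μ)

lemma trace_restrict_maxGenEigenspace_pow (f : End ℂ V) (μ : ℂ) (k : ℕ) :
    trace ℂ _ ((f ^ k).restrict
        (f.mapsTo_maxGenEigenspace_of_comm ((Commute.refl f).pow_right k) μ)) =
      μ ^ k * finrank ℂ (f.maxGenEigenspace μ) := by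
  induction k with
  | zero =>
    simp_rw [pow_zero, one_mul]
    rw [← trace_one ℂ (f.maxGenEigenspace μ)]
    congr 1
  | succ k ih =>
    rw [pow_succ' μ, mul_assoc, ← ih,
      ← trace_restrict_maxGenEigenspace_mul ((Commute.refl f).pow_right k)]
    rfl

lemma trace_pow_eq_sum (f : End ℂ V) (k : ℕ) :
    trace ℂ V (f ^ k) = ∑ μ ∈ (finite_maxGenEigenspace_ne_bot f).toFinset,
      μ ^ k * finrank ℂ (f.maxGenEigenspace μ) := by
  rw [trace_eq_sum_trace_restrict_maxGenEigenspace ((Commute.refl f).pow_right k)]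
  exact Finset.sum_congr rfl fun μ _ ↦ trace_restrict_maxGenEigenspace_pow f μ k

omit [FiniteDimensional ℂ V] in
lemma hasEigenvalue_of_maxGenEigenspace_ne_bot {f : End ℂ V} {μ : ℂ}
    (h : f.maxGenEigenspace μ ≠ ⊥) : f.HasEigenvalue μ :=
  End.HasUnifEigenvalue.lt (k := ⊤) zero_lt_one h

omit [FiniteDimensional ℂ V] in
lemma pow_eq_one_of_hasEigenvalue {f : End ℂ V} {N : ℕ} (hf : f ^ N = 1) {μ : ℂ}
    (h : f.HasEigenvalue μ) : μ ^ N = 1 := by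
  obtain ⟨v, hv⟩ := h.exists_hasEigenvector
  have := hv.pow_apply N
  rw [hf, End.one_apply] at this
  have h2 : (μ ^ N - 1) • v = 0 := by rw [sub_smul, one_smul, ← this, sub_self]
  exact sub_eq_zero.1 ((smul_eq_zero.1 h2).resolve_right hv.2)

lemma trace_pow_mem_galoisGraph {N : ℕ} [NeZero N] {σ : Gal(CyclotomicField N ℚ/ℚ)} {k : ℕ}
    (hσ : σ (IsCyclotomicExtension.zeta N ℚ _) = IsCyclotomicExtension.zeta N ℚ _ ^ k)
    {f : End ℂ V} (hf : f ^ N = 1) : (trace ℂ V f, trace ℂ V (f ^ k)) ∈ galoisGraph N σ := by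
  have h1 := trace_pow_eq_sum f 1
  rw [pow_one] at h1
  rw [h1, trace_pow_eq_sum f k]
  refine sum_mem_galoisGraph fun μ hμ ↦ ?_
  have hμ' := pow_eq_one_of_hasEigenvalue hf
    (hasEigenvalue_of_maxGenEigenspace_ne_bot ((Set.Finite.mem_toFinset _).1 hμ))
  rw [pow_one]
  exact mul_mem_galoisGraph (root_pow_mem_galoisGraph hσ hμ')
    (natCast_mem_galoisGraph _)

end Trace

section Weight

variable {Γ : Type} [Group Γ] [DecidableEq Γ] (S : Finset Γ)

/-- The class function whose convolution matrix is the Hermitian adjacency matrix. -/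
def hermitianWeight (g : Γ) : ℂ :=
  if g ∈ S then (if g⁻¹ ∈ S then 1 else Complex.I)
  else (if g⁻¹ ∈ S then -Complex.I else 0)

variable {S}

lemma hermitianWeight_inv (g : Γ) :
    hermitianWeight S g⁻¹ = starRingEnd ℂ (hermitianWeight S g) := by
  unfold hermitianWeight
  rw [inv_inv]
  split_ifs <;> simp

lemma hermitianWeight_eq_one_iff {g : Γ} :
    hermitianWeight S g = 1 ↔ g ∈ S ∧ g⁻¹ ∈ S := by
  unfold hermitianWeight
  split_ifs with h h' h' <;> simp [h, h', Complex.ext_iff]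

lemma hermitianWeight_eq_I_iff {g : Γ} :
    hermitianWeight S g = Complex.I ↔ g ∈ S ∧ g⁻¹ ∉ S := by
  unfold hermitianWeight
  split_ifs with h h' h' <;> norm_num [h, h', Complex.ext_iff]

lemma hermitianWeight_trichotomy (g : Γ) :
    hermitianWeight S g = 1 ∨ hermitianWeight S g = Complex.I ∨
      hermitianWeight S g⁻¹ = Complex.I ∨ hermitianWeight S g = 0 := by
  unfold hermitianWeight
  rw [inv_inv]
  split_ifs <;> simp

lemma isIntegral_hermitianWeight (g : Γ) : IsIntegral ℤ (hermitianWeight S g) := by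
  have hI : IsIntegral ℤ Complex.I := Complex.isIntegral_int_I
  unfold hermitianWeight
  split_ifs
  exacts [isIntegral_one, hI, hI.neg, isIntegral_zero]

lemma hermitianWeight_mul_comm (hS : ∀ s ∈ S, ∀ x : Γ, x * s * x⁻¹ ∈ S) (x g : Γ) :
    hermitianWeight S (x * g) = hermitianWeight S (g * x) := by
  have key (a b : Γ) : a * b ∈ S ↔ b * a ∈ S :=
    ⟨fun h ↦ by simpa [mul_assoc] using hS _ h b, fun h ↦ by simpa [mul_assoc] using hS _ h a⟩
  unfold hermitianWeight
  simp only [mul_inv_rev, key x g, key g⁻¹ x⁻¹]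

lemma Complex.I_pow_of_mod_four {k : ℕ} (hk : k % 2 = 1) :
    Complex.I ^ k = if k % 4 = 1 then Complex.I else starRingEnd ℂ Complex.I := by
  rw [← Nat.div_add_mod k 4, pow_add, pow_mul, Complex.I_pow_four, one_pow, one_mul]
  have : k % 4 = 1 ∨ k % 4 = 3 := by lia
  rcases this with h | h <;> simp [h, Complex.I_pow_three]

lemma hermitianWeight_mem_galoisGraph {N : ℕ} [NeZero N] (hN : 4 ∣ N)
    {σ : Gal(CyclotomicField N ℚ/ℚ)} {k : ℕ} (hk : k.Coprime N)
    (hσ : σ (IsCyclotomicExtension.zeta N ℚ _) = IsCyclotomicExtension.zeta N ℚ _ ^ k) (g : Γ) :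
    (hermitianWeight S g, if k % 4 = 1 then hermitianWeight S g
      else starRingEnd ℂ (hermitianWeight S g)) ∈ galoisGraph N σ := by
  have hk2 : k % 2 = 1 :=
    Nat.odd_iff.1 (Nat.coprime_two_right.1 (hk.coprime_dvd_right (Dvd.dvd.trans (by simp) hN)))
  have h1 : ((1 : ℂ), (1 : ℂ)) ∈ galoisGraph N σ := one_mem _
  have h0 : ((0 : ℂ), (0 : ℂ)) ∈ galoisGraph N σ := zero_mem _
  have hI : (Complex.I, Complex.I ^ k) ∈ galoisGraph N σ := by
    refine root_pow_mem_galoisGraph hσ ?_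
    obtain ⟨m, rfl⟩ := hN
    rw [pow_mul, Complex.I_pow_four, one_pow]
  rw [Complex.I_pow_of_mod_four hk2] at hI
  have hI' := neg_mem_galoisGraph hI
  unfold hermitianWeight
  split_ifs at * <;> simp_all

end Weight

section Translation

open LinearMap Module

variable {Γ : Type} [Group Γ]

/-- Translation of functions on a group: `(translation g v) a = v (g * a)`. -/
def translation (g : Γ) : End ℂ (Γ → ℂ) :=
  funLeft ℂ ℂ (g * ·)

@[simp]
lemma translation_apply (g : Γ) (v : Γ → ℂ) (a : Γ) : translation g v a = v (g * a) :=
  rfl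

lemma translation_mul (g h : Γ) : translation g * translation h = translation (h * g) := by
  ext
  simp [mul_assoc]

lemma translation_one : translation (1 : Γ) = 1 := by
  ext
  simp

lemma translation_pow (g : Γ) (k : ℕ) : translation (g ^ k) = translation g ^ k := by
  induction k with
  | zero => simp [translation_one]
  | succ k ih => rw [pow_succ, pow_succ', ih.symm, translation_mul]

variable [Fintype Γ] [DecidableEq Γ]

lemma trace_translation (g : Γ) :
    trace ℂ _ (translation g) = if g = 1 then (Fintype.card Γ : ℂ) else 0 := by
  rw [trace_eq_matrix_trace ℂ (Pi.basisFun ℂ Γ), Matrix.trace]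
  simp [LinearMap.toMatrix'_apply, Pi.single_apply]

/-- The Hermitian adjacency matrix as an endomorphism of the space of functions on the group. -/
def hermitianOperator (S : Finset Γ) : End ℂ (Γ → ℂ) :=
  Matrix.toLin' (hermitianAdjMatrix S)

variable {S : Finset Γ}

lemma hasEigenvalue_hermitianOperator_iff {z : ℂ} :
    (hermitianOperator S).HasEigenvalue z ↔ z ∈ spectrum ℂ (hermitianAdjMatrix S) := by
  rw [End.hasEigenvalue_iff_mem_spectrum, hermitianOperator, Matrix.spectrum_toLin']

lemma hermitianOperator_eq_sum_translation :
    hermitianOperator S = ∑ g, hermitianWeight S g • translation g := by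
  refine LinearMap.ext fun v ↦ funext fun a ↦ ?_
  simp only [hermitianOperator, Matrix.toLin'_apply, Matrix.mulVec, dotProduct, LinearMap.sum_apply,
    Finset.sum_apply, LinearMap.smul_apply, Pi.smul_apply, translation_apply, smul_eq_mul]
  rw [← Equiv.sum_comp (Equiv.mulRight a)]
  simp [hermitianAdjMatrix, hermitianWeight]

lemma commute_hermitianOperator_translation (hS : ∀ s ∈ S, ∀ x : Γ, x * s * x⁻¹ ∈ S) (x : Γ) :
    Commute (hermitianOperator S) (translation x) := by
  rw [hermitianOperator_eq_sum_translation, Commute, SemiconjBy, Finset.sum_mul, Finset.mul_sum,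
    ← Equiv.sum_comp ((Equiv.mulLeft x⁻¹).trans (Equiv.mulRight x))]
  refine Finset.sum_congr rfl fun g _ ↦ ?_
  rw [smul_mul_assoc, mul_smul_comm, translation_mul, translation_mul]
  simp [mul_assoc, hermitianWeight_mul_comm hS x⁻¹]

lemma trace_translation_mul_hermitianOperator (x : Γ) :
    trace ℂ _ (translation x * hermitianOperator S) =
      Fintype.card Γ * hermitianWeight S x⁻¹ := by
  simp_rw [hermitianOperator_eq_sum_translation, Finset.mul_sum, mul_smul_comm, translation_mul,
    map_sum, map_smul, trace_translation, mul_eq_one_iff_eq_inv]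
  simp [mul_comm]

lemma isIntegral_of_mem_spectrum_hermitianAdjMatrix {z : ℂ}
    (hz : z ∈ spectrum ℂ (hermitianAdjMatrix S)) : IsIntegral ℤ z := by
  let M : Matrix Γ Γ (integralClosure ℤ ℂ) :=
    Matrix.of fun a b ↦ ⟨hermitianWeight S (b * a⁻¹), isIntegral_hermitianWeight _⟩
  have hM : M.map (algebraMap (integralClosure ℤ ℂ) ℂ) = hermitianAdjMatrix S := by
    ext a b
    simp [M, hermitianAdjMatrix, hermitianWeight]
  rw [Matrix.mem_spectrum_iff_isRoot_charpoly, ← hM, Matrix.charpoly_map, Polynomial.IsRoot,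
    Polynomial.eval_map] at hz
  have : IsIntegral (integralClosure ℤ ℂ) z := ⟨M.charpoly, M.charpoly_monic, hz⟩
  exact isIntegral_trans z this

end Translation

section Integrality

open LinearMap Module

variable {Γ : Type} [Group Γ] [Fintype Γ] [DecidableEq Γ] {S : Finset Γ}

omit [DecidableEq Γ] in
lemma translation_pow_four_mul_card (g : Γ) : translation g ^ (4 * Fintype.card Γ) = 1 := by
  rw [← translation_pow, mul_comm, pow_mul, pow_card_eq_one, one_pow, translation_one]

/-- The character of `Γ` on a generalized eigenspace of the Hermitian adjacency matrix. -/
def eigenCharacter (hS : ∀ s ∈ S, ∀ x : Γ, x * s * x⁻¹ ∈ S) (μ : ℂ) (g : Γ) : ℂ :=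
  trace ℂ _ ((translation g).restrict ((hermitianOperator S).mapsTo_maxGenEigenspace_of_comm
    (commute_hermitianOperator_translation hS g) μ))

variable (hS : ∀ s ∈ S, ∀ x : Γ, x * s * x⁻¹ ∈ S)
include hS

lemma eigenCharacter_mem_galoisGraph [NeZero (4 * Fintype.card Γ)] {k : ℕ}
    {σ : Gal(CyclotomicField (4 * Fintype.card Γ) ℚ/ℚ)}
    (hσ : σ (IsCyclotomicExtension.zeta (4 * Fintype.card Γ) ℚ _) =
      IsCyclotomicExtension.zeta (4 * Fintype.card Γ) ℚ _ ^ k)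
    (μ : ℂ) (g : Γ) :
    (eigenCharacter hS μ g, eigenCharacter hS μ (g ^ k)) ∈
      galoisGraph (4 * Fintype.card Γ) σ := by
  have hmaps (x : Γ) : ∀ v ∈ (hermitianOperator S).maxGenEigenspace μ,
      translation x v ∈ (hermitianOperator S).maxGenEigenspace μ :=
    (hermitianOperator S).mapsTo_maxGenEigenspace_of_comm
      (commute_hermitianOperator_translation hS x) μ
  have hpow (n : ℕ) : (translation g).restrict (hmaps g) ^ n =
      (translation (g ^ n)).restrict (hmaps (g ^ n)) := by
    rw [Module.End.pow_restrict]
    simp_rw [translation_pow]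
  have h1 : (translation g).restrict (hmaps g) ^ (4 * Fintype.card Γ) = 1 := by
    rw [Module.End.pow_restrict]
    simp_rw [translation_pow_four_mul_card]
    rfl
  have := trace_pow_mem_galoisGraph hσ h1
  rwa [hpow k] at this

lemma card_mul_hermitianWeight_inv (g : Γ) :
    Fintype.card Γ * hermitianWeight S g⁻¹ =
      ∑ μ ∈ (finite_maxGenEigenspace_ne_bot
        (hermitianOperator S)).toFinset, μ * eigenCharacter hS μ g := by
  have h := commute_hermitianOperator_translation hS g
  rw [← trace_translation_mul_hermitianOperator,
    trace_eq_sum_trace_restrict_maxGenEigenspace (h.mul_right (Commute.refl _))]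
  exact Finset.sum_congr rfl fun μ _ ↦ trace_restrict_maxGenEigenspace_mul h μ

lemma eigenvalue_mul_finrank_eq_sum (μ : ℂ) :
    μ * finrank ℂ ((hermitianOperator S).maxGenEigenspace μ) =
      ∑ g, hermitianWeight S g * eigenCharacter hS μ g := by
  have h := trace_restrict_maxGenEigenspace_pow (hermitianOperator S) μ 1
  simp_rw [pow_one] at h
  rw [← h]
  simp_rw [eigenCharacter, ← smul_eq_mul, ← map_smul]
  rw [← map_sum]
  congr 1
  ext v
  simp [hermitianOperator_eq_sum_translation]
  rfl

lemma matrixIntegral_iff_hermitianWeight_pow :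
    MatrixIntegral (hermitianAdjMatrix S) ↔
      ∀ k : ℕ, k.Coprime (4 * Fintype.card Γ) → ∀ g, hermitianWeight S (g ^ k) =
        if k % 4 = 1 then hermitianWeight S g else starRingEnd ℂ (hermitianWeight S g) := by
  have hcard : (Fintype.card Γ : ℂ) ≠ 0 := by simp
  have : NeZero (4 * Fintype.card Γ) := ⟨by simp⟩
  constructor
  · intro hint k hk g
    obtain ⟨σ, hσ⟩ := exists_galois_of_coprime hk
    have h1 : (Fintype.card Γ * hermitianWeight S g⁻¹⁻¹,
        Fintype.card Γ * hermitianWeight S (g⁻¹ ^ k)⁻¹) ∈ galoisGraph _ σ := by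
      rw [card_mul_hermitianWeight_inv hS, card_mul_hermitianWeight_inv hS]
      refine sum_mem_galoisGraph fun μ hμ ↦ mul_mem_galoisGraph ?_
        (eigenCharacter_mem_galoisGraph hS hσ μ g⁻¹)
      obtain ⟨m, rfl⟩ := hint μ <| hasEigenvalue_hermitianOperator_iff.1 <|
        hasEigenvalue_of_maxGenEigenspace_ne_bot ((Set.Finite.mem_toFinset _).1 hμ)
      exact_mod_cast ratCast_mem_galoisGraph (σ := σ) m
    rw [inv_pow, inv_inv, inv_inv] at h1
    exact mul_left_cancel₀ hcard (galoisGraph_functional h1 (mul_mem_galoisGraph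
      (natCast_mem_galoisGraph _) (hermitianWeight_mem_galoisGraph (dvd_mul_right _ _) hk hσ g)))
  · intro hpow z hz
    set E := (hermitianOperator S).maxGenEigenspace z with hE
    have hEbot : E ≠ ⊥ :=
      End.HasUnifEigenvalue.lt (k := 1) (by simp) (hasEigenvalue_hermitianOperator_iff.2 hz)
    have hdim : (finrank ℂ E : ℂ) ≠ 0 := by
      simpa using hEbot
    obtain ⟨q, hq⟩ : ∃ q : ℚ, z * finrank ℂ E = q := by
      refine exists_rat_of_galoisGraph_diag (N := 4 * Fintype.card Γ) fun σ ↦ ?_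
      obtain ⟨k, hk, hσ⟩ := exists_coprime_of_galois σ
      have hcop : (Nat.card Γ).Coprime k := by
        rw [Nat.card_eq_fintype_card]
        exact (hk.coprime_dvd_right (dvd_mul_left _ _)).symm
      have h1 := eigenvalue_mul_finrank_eq_sum hS z
      have h2 := h1
      rw [← Equiv.sum_comp (powCoprime hcop)] at h2
      nth_rw 1 [h1]
      rw [h2]
      refine sum_mem_galoisGraph fun g _ ↦ mul_mem_galoisGraph ?_
        (eigenCharacter_mem_galoisGraph hS hσ z g)
      rw [powCoprime_apply, hpow k hk]
      exact hermitianWeight_mem_galoisGraph (dvd_mul_right _ _) hk hσ g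
    have hz' : z = algebraMap ℚ ℂ (q / finrank ℂ E) := by
      rw [eq_ratCast, Rat.cast_div, Rat.cast_natCast, ← hq, mul_div_cancel_right₀ _ hdim]
    have hzi := isIntegral_of_mem_spectrum_hermitianAdjMatrix hz
    rw [hz', isIntegral_algebraMap_iff (algebraMap ℚ ℂ).injective,
      IsIntegrallyClosed.isIntegral_iff] at hzi
    obtain ⟨m, hm⟩ := hzi
    exact ⟨m, by rw [hz', ← hm]; simp⟩

end Integrality

section Orbits

variable {Γ : Type} [Group Γ] [Fintype Γ]

lemma Nat.exists_coprime_modEq_of_dvd {d N j : ℕ} [NeZero N] (hd : d ∣ N) (hj : j.Coprime d) :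
    ∃ k : ℕ, k.Coprime N ∧ k ≡ j [MOD d] := by
  obtain ⟨u, hu⟩ := ZMod.unitsMap_surjective hd (ZMod.unitOfCoprime j hj)
  refine ⟨(u : ZMod N).val, ZMod.val_coe_unit_coprime u, ?_⟩
  have := congrArg Units.val hu
  rw [ZMod.unitsMap_val, ZMod.coe_unitOfCoprime] at this
  rw [← ZMod.natCast_eq_natCast_iff, ← this, ZMod.natCast_val]

lemma exists_coprime_pow_eq_of_zpowers_eq {N : ℕ} [NeZero N] {x y : Γ} (hN : orderOf x ∣ N)
    (h : Subgroup.zpowers y = Subgroup.zpowers x) : ∃ k : ℕ, k.Coprime N ∧ x ^ k = y := by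
  obtain ⟨j, rfl⟩ := mem_powers_iff_mem_zpowers.2 (h ▸ Subgroup.mem_zpowers y)
  have ho : orderOf (x ^ j) = orderOf x := by
    rw [← Nat.card_zpowers, h, Nat.card_zpowers]
  have hj : j.Coprime (orderOf x) := by
    rw [orderOf_pow, Nat.div_eq_self] at ho
    rw [Nat.coprime_comm]
    exact ho.resolve_left (orderOf_pos x).ne'
  obtain ⟨k, hk, hkj⟩ := Nat.exists_coprime_modEq_of_dvd hN hj
  exact ⟨k, hk, pow_eq_pow_iff_modEq.2 hkj⟩

variable [DecidableEq Γ] {S : Finset Γ}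

lemma hermitianWeight_pow_iff :
    (∀ k : ℕ, k.Coprime (4 * Fintype.card Γ) → ∀ g : Γ, hermitianWeight S (g ^ k) =
        if k % 4 = 1 then hermitianWeight S g else starRingEnd ℂ (hermitianWeight S g)) ↔
      ∀ k : ℕ, k.Coprime (4 * Fintype.card Γ) → k % 4 = 1 → ∀ g : Γ,
        hermitianWeight S (g ^ k) = hermitianWeight S g := by
  refine ⟨fun h k hk hk4 g ↦ by rw [h k hk, if_pos hk4], fun h k hk g ↦ ?_⟩
  split_ifs with hk4
  · exact h k hk hk4 g
  have hpos : 1 ≤ Fintype.card Γ := Fintype.card_pos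
  have hk2 : k % 2 = 1 := Nat.odd_iff.1 (Nat.coprime_two_right.1
    (hk.coprime_dvd_right (Dvd.dvd.mul_right (by norm_num) _)))
  have hinv : g ^ (k * (4 * Fintype.card Γ - 1)) = (g ^ k)⁻¹ := by
    rw [eq_inv_iff_mul_eq_one, ← pow_add, ← Nat.mul_succ, Nat.succ_eq_add_one,
      Nat.sub_add_cancel (by lia), ← mul_assoc, pow_mul, pow_card_eq_one]
  have hlast : (4 * Fintype.card Γ - 1).Coprime (4 * Fintype.card Γ) :=
    (Nat.coprime_self_sub_left (by lia)).2 (Nat.coprime_one_left _)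
  have := h (k * (4 * Fintype.card Γ - 1)) (hk.mul_left hlast) (by
    rw [Nat.mul_mod, show k % 4 = 3 by lia, show (4 * Fintype.card Γ - 1) % 4 = 3 by lia]) g
  rw [hinv, hermitianWeight_inv] at this
  rw [← this, Complex.conj_conj]

omit [DecidableEq Γ] in
lemma orderOf_dvd_four_mul_card (x : Γ) : orderOf x ∣ 4 * Fintype.card Γ :=
  orderOf_dvd_card.mul_left 4

lemma hermitianWeight_pow_of_coprime
    (h : ∀ k : ℕ, k.Coprime (4 * Fintype.card Γ) → ∀ g : Γ, hermitianWeight S (g ^ k) =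
      if k % 4 = 1 then hermitianWeight S g else starRingEnd ℂ (hermitianWeight S g))
    {x : Γ} {j : ℕ} (hj : j.Coprime (4 * orderOf x)) :
    hermitianWeight S (x ^ j) =
      if j % 4 = 1 then hermitianWeight S x else starRingEnd ℂ (hermitianWeight S x) := by
  have : NeZero (4 * Fintype.card Γ) := ⟨by simp⟩
  obtain ⟨k, hk, hkj⟩ := Nat.exists_coprime_modEq_of_dvd
    (Nat.mul_dvd_mul_left 4 (orderOf_dvd_card (x := x))) hj
  have h4 : k % 4 = j % 4 := hkj.of_mul_right _
  rw [← pow_eq_pow_iff_modEq.2 (hkj.of_mul_left _), h k hk, h4]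

lemma hermitianWeight_pow_iff_orbits :
    (∀ k : ℕ, k.Coprime (4 * Fintype.card Γ) → ∀ g : Γ, hermitianWeight S (g ^ k) =
        if k % 4 = 1 then hermitianWeight S g else starRingEnd ℂ (hermitianWeight S g)) ↔
      (∀ x, hermitianWeight S x = 1 → ∀ y ∈ atom1 x, hermitianWeight S y = 1) ∧
      (∀ x, hermitianWeight S x = Complex.I → 4 ∣ orderOf x) ∧
      (∀ x, hermitianWeight S x = Complex.I → ∀ y ∈ bracket4 x,
        hermitianWeight S y = Complex.I) := by
  have : NeZero (4 * Fintype.card Γ) := ⟨by simp⟩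
  constructor
  · intro h
    refine ⟨fun x hx y hy ↦ ?_, fun x hx ↦ ?_, fun x hx y hy ↦ ?_⟩
    · obtain ⟨k, hk, rfl⟩ := exists_coprime_pow_eq_of_zpowers_eq (orderOf_dvd_four_mul_card x) hy
      rw [h k hk, hx, map_one, ite_self]
    · by_contra hord
      obtain ⟨c, hc⟩ : ∃ c, (orderOf x * c) % 4 = 2 := by
        have : orderOf x % 4 = 1 ∨ orderOf x % 4 = 2 ∨ orderOf x % 4 = 3 := by lia
        rcases this with h | h | h
        exacts [⟨2, by lia⟩, ⟨1, by lia⟩, ⟨2, by lia⟩]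
      have hcop : (orderOf x * c + 1).Coprime (4 * orderOf x) := by
        refine Nat.Coprime.mul_right ?_ (by simp)
        exact Nat.Coprime.pow_right 2 (Nat.coprime_two_right.2 (Nat.odd_iff.2 (by lia)))
      have hpow := hermitianWeight_pow_of_coprime h hcop
      rw [if_neg (by lia), pow_succ, pow_mul, pow_orderOf_eq_one, one_pow, one_mul, hx] at hpow
      norm_num [Complex.ext_iff] at hpow
    · obtain ⟨k, -, -, hk, hk4, rfl⟩ := hy
      have hcop : k.Coprime (4 * orderOf x) := by
        refine Nat.Coprime.mul_right ?_ hk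
        exact Nat.Coprime.pow_right 2 (Nat.coprime_two_right.2 (Nat.odd_iff.2 (by lia)))
      rw [hermitianWeight_pow_of_coprime h hcop, if_pos hk4, hx]
  · rintro ⟨hone, hord, hI⟩
    rw [hermitianWeight_pow_iff]
    have key (k : ℕ) (hk : k.Coprime (4 * Fintype.card Γ)) (hk4 : k % 4 = 1) (g : Γ)
        (hg : hermitianWeight S g = Complex.I) : hermitianWeight S (g ^ k) = Complex.I := by
      have hdvd := hord g hg
      have hpos := orderOf_pos g
      have hmod : k % orderOf g % 4 = 1 := by rw [Nat.mod_mod_of_dvd _ hdvd, hk4]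
      have hlt := Nat.mod_lt k hpos
      refine hI g hg _ ⟨k % orderOf g, by lia, by lia, ?_, hmod, (pow_mod_orderOf g k).symm⟩
      rw [← Nat.gcd_rec, Nat.gcd_comm]
      exact hk.coprime_dvd_right (orderOf_dvd_four_mul_card g)
    have hne (k : ℕ) (hk : k.Coprime (4 * Fintype.card Γ)) (hk4 : k % 4 = 1) (g : Γ)
        (hg : hermitianWeight S g ≠ 0) : hermitianWeight S (g ^ k) = hermitianWeight S g := by
      rcases hermitianWeight_trichotomy (S := S) g with h | h | h | h
      · rw [h]
        refine hone g h _ ?_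
        have hcop := hk.coprime_dvd_right (orderOf_dvd_four_mul_card g)
        refine le_antisymm (Subgroup.zpowers_le.2 (Subgroup.npow_mem_zpowers g k))
          (Subgroup.zpowers_le.2 ?_)
        exact (mem_zpowers_pow_iff).2 hcop
      · rw [h, key k hk hk4 g h]
      · rw [← inv_inv (g ^ k), hermitianWeight_inv, ← inv_pow, key k hk hk4 _ h, ← h,
          hermitianWeight_inv, Complex.conj_conj]
      · exact absurd h hg
    intro k hk hk4 g
    by_cases hg : hermitianWeight S g = 0
    · by_contra hgk
      obtain ⟨m, hm, hkm⟩ : ∃ m : ℕ, m.Coprime (4 * Fintype.card Γ) ∧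
          k * m ≡ 1 [MOD 4 * Fintype.card Γ] := by
        refine ⟨_, ZMod.val_coe_unit_coprime (ZMod.unitOfCoprime k hk)⁻¹, ?_⟩
        rw [← ZMod.natCast_eq_natCast_iff]
        rw [Nat.cast_mul, ZMod.natCast_val, ZMod.cast_id, Nat.cast_one,
          ← ZMod.coe_unitOfCoprime k hk, Units.mul_inv]
      have hm4 : m % 4 = 1 := by
        have : k * m % 4 = 1 := hkm.of_mul_right _
        rw [Nat.mul_mod, hk4] at this
        lia
      rw [hg] at hgk
      have := hne m hm hm4 (g ^ k) hgk
      rw [← pow_mul, pow_eq_pow_iff_modEq.2 (hkm.of_dvd (orderOf_dvd_four_mul_card g)), pow_one,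
        hg] at this
      exact hgk this.symm
    · exact hne k hk hk4 g hg

end Orbits

/-- A normal mixed Cayley graph `Cay(Γ, S)` is H-integral if and only if `S∖S̄ ∈ B(Γ)` and
`S̄ ∈ D(Γ)`: `[x] ⊆ S∖S̄` for every `x ∈ S∖S̄`, and `S̄ ⊆ Γ(4)` with `⟦x⟧ ⊆ S̄` for every
`x ∈ S̄`. -/
theorem normal_mixed_cayley_HIntegral_iff
    (Γ : Type) [Group Γ] [Fintype Γ] [DecidableEq Γ]
    (S : Finset Γ) (hS1 : (1 : Γ) ∉ S)
    (hnormal : ∀ s ∈ S, ∀ x : Γ, x * s * x⁻¹ ∈ S) :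
    MatrixIntegral (hermitianAdjMatrix S)
      ↔ ((∀ x ∈ S \ S.filter (fun s => s⁻¹ ∉ S),
            atom1 x ⊆ ((S \ S.filter (fun s => s⁻¹ ∉ S) : Finset Γ) : Set Γ))
        ∧ (∀ x ∈ S.filter (fun s => s⁻¹ ∉ S), 4 ∣ orderOf x)
        ∧ (∀ x ∈ S.filter (fun s => s⁻¹ ∉ S),
            bracket4 x ⊆ ((S.filter (fun s => s⁻¹ ∉ S) : Finset Γ) : Set Γ))) := by
  rw [matrixIntegral_iff_hermitianWeight_pow hnormal, hermitianWeight_pow_iff_orbits]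
  have hone (x : Γ) : x ∈ S \ S.filter (fun s => s⁻¹ ∉ S) ↔ hermitianWeight S x = 1 := by
    rw [hermitianWeight_eq_one_iff]
    simp +contextual [iff_def]
  have hI (x : Γ) : x ∈ S.filter (fun s => s⁻¹ ∉ S) ↔ hermitianWeight S x = Complex.I := by
    rw [hermitianWeight_eq_I_iff, Finset.mem_filter]
  simp only [Set.subset_def, Finset.mem_coe, hone, hI]
end
end
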